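/- Let γ_ℝ be the standard Gaussian measure on ℝ and, for h ∈ ℝ, let γ_{ℝ,h} be γ_ℝ shifted by h. Then there exists a constant C such that for all y, h ∈ ℝ, ∫_ℝ exp( (1/2) | log|x+y| − log|x−y| | ) γ_{ℝ,h}(dx) ≤ exp(C √|y|). -/

import Mathlib

open MeasureTheory ProbabilityTheory
open scoped ENNReal

lemma exp_half_log_sub_log_le {a b d : ℝ} (ha : 0 < a) (hb : 0 < b) (hd : 0 ≤ d)
    (hab : a ≤ b + d) :
    Real.exp ((1 / 2) * (Real.log a - Real.log b)) ≤ 1 + √d * (√b)⁻¹ := by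
  have hsb : 0 < √b := Real.sqrt_pos.2 hb
  have h1 : Real.exp ((1 / 2) * (Real.log a - Real.log b)) = √a / √b := by
    rw [← Real.exp_log (Real.sqrt_pos.2 ha), ← Real.exp_log hsb, ← Real.exp_sub,
      Real.log_sqrt ha.le, Real.log_sqrt hb.le]
    congr 1
    ring
  have h2 : √a ≤ √b + √d := by
    refine Real.sqrt_le_iff.2 ⟨by positivity, ?_⟩
    nlinarith [Real.sq_sqrt hb.le, Real.sq_sqrt hd, Real.sqrt_nonneg b, Real.sqrt_nonneg d]
  rw [h1, div_le_iff₀ hsb]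
  calc √a ≤ √b + √d := h2
    _ = (1 + √d * (√b)⁻¹) * √b := by field_simp

lemma exp_half_abs_log_sub_log_le {a b d : ℝ} (ha : 0 < a) (hb : 0 < b) (hd : 0 ≤ d)
    (hab : a ≤ b + d) (hba : b ≤ a + d) :
    Real.exp ((1 / 2) * |Real.log a - Real.log b|) ≤ 1 + √d * ((√a)⁻¹ + (√b)⁻¹) := by
  have h1 := exp_half_log_sub_log_le ha hb hd hab
  have h2 := exp_half_log_sub_log_le hb ha hd hba
  have h3 : 0 ≤ √d * (√a)⁻¹ := by positivity
  have h4 : 0 ≤ √d * (√b)⁻¹ := by positivity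
  rcases abs_cases (Real.log a - Real.log b) with ⟨h, -⟩ | ⟨h, -⟩ <;> rw [h]
  · linarith
  · rw [neg_sub]
    linarith

/-- The function `|t| ^ (-1/2)` cut off to `0 < |t| ≤ 1`. -/
noncomputable def truncInvSqrt (t : ℝ) : ℝ :=
  (Set.Ioc (0 : ℝ) 1).indicator (fun s ↦ (√s)⁻¹) |t|

lemma truncInvSqrt_nonneg (t : ℝ) : 0 ≤ truncInvSqrt t :=
  Set.indicator_nonneg (fun _ _ ↦ by positivity) _

lemma inv_sqrt_abs_le (t : ℝ) : (√|t|)⁻¹ ≤ 1 + truncInvSqrt t := by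
  by_cases h : |t| ∈ Set.Ioc (0 : ℝ) 1
  · simp [truncInvSqrt, Set.indicator_of_mem h]
  · rcases (abs_nonneg t).eq_or_lt with h0 | h0
    · rw [← h0]
      simpa using add_nonneg zero_le_one (truncInvSqrt_nonneg t)
    · have h1 : 1 ≤ |t| := by
        by_contra! h1
        exact h ⟨h0, h1.le⟩
      have := inv_le_one_of_one_le₀ (Real.one_le_sqrt.2 h1)
      linarith [truncInvSqrt_nonneg t]

lemma integrable_truncInvSqrt : Integrable truncInvSqrt := by
  refine (integrable_fun_norm_addHaar volume
    (f := (Set.Ioc (0 : ℝ) 1).indicator fun s ↦ (√s)⁻¹)).2 ?_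
  refine Integrable.integrableOn ?_
  simp only [Module.finrank_self, tsub_self, pow_zero, one_smul]
  rw [integrable_indicator_iff measurableSet_Ioc]
  have h := (intervalIntegrable_iff_integrableOn_Ioc_of_le zero_le_one).1
    (intervalIntegral.intervalIntegrable_rpow' (a := 0) (b := 1) (r := -(1 / 2)) (by norm_num))
  refine h.congr_fun (fun s hs ↦ ?_) measurableSet_Ioc
  simp only [Real.rpow_neg hs.1.le, Real.sqrt_eq_rpow]

lemma gaussianReal_zero_one_le_volume : gaussianReal 0 1 ≤ volume := by
  rw [gaussianReal_of_var_ne_zero 0 one_ne_zero]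
  calc volume.withDensity (gaussianPDF 0 1) ≤ volume.withDensity 1 := by
        refine withDensity_mono (Filter.Eventually.of_forall fun x ↦ ?_)
        rw [gaussianPDF, Pi.one_apply, ENNReal.ofReal_le_one, gaussianPDFReal]
        refine mul_le_one₀ (inv_le_one_of_one_le₀ (Real.one_le_sqrt.2 ?_)) (Real.exp_pos _).le
          (Real.exp_le_one_iff.2 ?_)
        · have := Real.pi_gt_three
          simp only [NNReal.coe_one]
          linarith
        · simp only [NNReal.coe_one, sub_zero, mul_one]
          have := sq_nonneg x
          linarith
    _ = volume := withDensity_one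

lemma integrable_truncInvSqrt_add_gaussianReal (c : ℝ) :
    Integrable (fun x ↦ truncInvSqrt (x + c)) (gaussianReal 0 1) :=
  (integrable_truncInvSqrt.comp_add_right c).mono_measure gaussianReal_zero_one_le_volume

lemma integral_truncInvSqrt_add_gaussianReal_le (c : ℝ) :
    ∫ x, truncInvSqrt (x + c) ∂(gaussianReal 0 1) ≤ ∫ x, truncInvSqrt x := by
  rw [← integral_add_right_eq_self truncInvSqrt c]
  exact integral_mono_measure gaussianReal_zero_one_le_volume
    (Filter.Eventually.of_forall fun _ ↦ truncInvSqrt_nonneg _)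
    (integrable_truncInvSqrt.comp_add_right c)

/-- Let `γ_ℝ` be the standard Gaussian measure on `ℝ` and `γ_{ℝ,h}` its
shift by `h`.  Then there is a constant `C` such that for all `y, h ∈ ℝ`,
`∫_ℝ exp ((1/2) |log|x+y| − log|x−y||) γ_{ℝ,h}(dx) ≤ exp (C √|y|)`
(the shifted measure being realized by evaluating the integrand at `x + h`). -/
theorem stmt7 :
    ∃ C : ℝ, ∀ y h : ℝ,
      ∫⁻ x, ENNReal.ofReal
          (Real.exp ((1 / 2) * |Real.log (abs (x + h + y)) - Real.log (abs (x + h - y))|))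
          ∂(gaussianReal 0 1)
        ≤ ENNReal.ofReal (Real.exp (C * Real.sqrt |y|)) := by
  refine ⟨√2 * (2 + 2 * ∫ x, truncInvSqrt x), fun y h ↦ ?_⟩
  have : NullSingletonClass (gaussianReal 0 1) := nullSingletonClass_gaussianReal one_ne_zero
  set F : ℝ → ℝ := fun x ↦
    1 + √(2 * |y|) * (2 + (truncInvSqrt (x + (h + y)) + truncInvSqrt (x + (h - y)))) with hF
  have hFint₁ := integrable_truncInvSqrt_add_gaussianReal (h + y)
  have hFint₂ := integrable_truncInvSqrt_add_gaussianReal (h - y)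
  have hFint : Integrable F (gaussianReal 0 1) :=
    (integrable_const _).add (((integrable_const _).add (hFint₁.add hFint₂)).const_mul _)
  have hF0 : ∀ x, 0 ≤ F x := fun x ↦ by
    have := truncInvSqrt_nonneg (x + (h + y))
    have := truncInvSqrt_nonneg (x + (h - y))
    positivity
  have hIF : ∫ x, F x ∂(gaussianReal 0 1) = 1 + √(2 * |y|) *
      (2 + (∫ x, truncInvSqrt (x + (h + y)) ∂(gaussianReal 0 1)
        + ∫ x, truncInvSqrt (x + (h - y)) ∂(gaussianReal 0 1))) := by
    have hFint₃ := hFint₁.add hFint₂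
    have hFint₄ := ((integrable_const (2 : ℝ)).add hFint₃).const_mul √(2 * |y|)
    simp only [Pi.add_def] at hFint₃ hFint₄
    simp only [hF]
    rw [integral_add (integrable_const _) hFint₄, integral_const_mul,
      integral_add (integrable_const _) hFint₃, integral_add hFint₁ hFint₂]
    simp
  calc _ ≤ ∫⁻ x, ENNReal.ofReal (F x) ∂(gaussianReal 0 1) := by
        refine lintegral_mono_ae ?_
        filter_upwards [Measure.ae_ne (gaussianReal 0 1) (-(h + y)),
          Measure.ae_ne (gaussianReal 0 1) (-(h - y))] with x hx₁ hx₂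
        refine ENNReal.ofReal_le_ofReal ?_
        have e₁ : x + h + y = x + (h + y) := by ring
        have e₂ : x + h - y = x + (h - y) := by ring
        rw [e₁, e₂]
        have hd : |2 * y| = 2 * |y| := by simp [abs_mul]
        refine (exp_half_abs_log_sub_log_le (d := 2 * |y|)
          (abs_pos.2 fun h0 ↦ hx₁ (by linarith)) (abs_pos.2 fun h0 ↦ hx₂ (by linarith))
          (by positivity) ?_ ?_).trans ?_
        · rw [← hd]
          refine le_trans (le_of_eq ?_) (abs_add_le (x + (h - y)) (2 * y))
          congr 1
          ring
        · rw [← hd]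
          refine le_trans (le_of_eq ?_) (abs_sub (x + (h + y)) (2 * y))
          congr 1
          ring
        · have := inv_sqrt_abs_le (x + (h + y))
          have := inv_sqrt_abs_le (x + (h - y))
          exact add_le_add_right
            (mul_le_mul_of_nonneg_left (by linarith) (Real.sqrt_nonneg _)) 1
    _ = ENNReal.ofReal (∫ x, F x ∂(gaussianReal 0 1)) :=
        (ofReal_integral_eq_lintegral_ofReal hFint (Filter.Eventually.of_forall hF0)).symm
    _ ≤ _ := by
        refine ENNReal.ofReal_le_ofReal ?_
        rw [hIF, Real.sqrt_mul zero_le_two]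
        have h₁ := integral_truncInvSqrt_add_gaussianReal_le (h + y)
        have h₂ := integral_truncInvSqrt_add_gaussianReal_le (h - y)
        refine le_trans ?_ (Real.add_one_le_exp _)
        have : √2 * √|y| * (2 + (∫ x, truncInvSqrt (x + (h + y)) ∂(gaussianReal 0 1)
            + ∫ x, truncInvSqrt (x + (h - y)) ∂(gaussianReal 0 1)))
            ≤ √2 * √|y| * (2 + 2 * ∫ x, truncInvSqrt x) := by
          gcongr
          linarith
        linarith
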